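/- Let p > 2. For every z ∈ (0, (p/2)^(1/(p−2))) with z ≠ 1 the following two identities hold: (i) √2 · L₁(z) · (f(z) − f(1)) = −∫_{a(z)}^{b(z)} √(f(t) − f(z)) · (3 − 2 (f(t) − f(1)) f''(t) / f'(t)²) dt; and (ii) L₁ is differentiable at z with √2 · L₁'(z) · (f(z) − f(1)) = −f'(z) · ∫_{a(z)}^{b(z)} √(f(t) − f(z)) · g(t) / f'(t)⁴ dt, where g(t) = −3 f''(t) f'(t)² + 6 (f(t) − f(1)) f''(t)² − 2 (f(t) − f(1)) f'''(t) f'(t). -/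

import Mathlib

open MeasureTheory

/-- `f(t) = t²/2 - tᵖ/p`. -/
noncomputable def f (p t : ℝ) : ℝ := t ^ 2 / 2 - t ^ p / p

/-- First derivative: `f'(t) = t - t^(p-1)`. -/
noncomputable def f' (p t : ℝ) : ℝ := t - t ^ (p - 1)

/-- Second derivative: `f''(t) = 1 - (p-1) t^(p-2)`. -/
noncomputable def f'' (p t : ℝ) : ℝ := 1 - (p - 1) * t ^ (p - 2)

/-- Third derivative: `f'''(t) = -(p-1)(p-2) t^(p-3)`. -/
noncomputable def f''' (p t : ℝ) : ℝ := -(p - 1) * (p - 2) * t ^ (p - 3)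

/-- `g(t) = -3 f''(t) f'(t)² + 6 (f(t)-f(1)) f''(t)² - 2 (f(t)-f(1)) f'''(t) f'(t)`. -/
noncomputable def g (p t : ℝ) : ℝ :=
  -3 * f'' p t * (f' p t) ^ 2 + 6 * (f p t - f p 1) * (f'' p t) ^ 2
    - 2 * (f p t - f p 1) * f''' p t * f' p t

open Set Filter Topology

theorem analyticAt_rpow_const {t : ℝ} (ht : 0 < t) (q : ℝ) :
    AnalyticAt ℝ (fun x : ℝ => x ^ q) t := by
  have h : AnalyticAt ℝ (fun x : ℝ => Real.exp (Real.log x * q)) t :=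
    ((analyticAt_log ht).mul analyticAt_const).rexp'
  refine h.congr ?_
  filter_upwards [eventually_gt_nhds ht] with x hx
  rw [Real.rpow_def_of_pos hx]

theorem hasDerivAt_f {p t : ℝ} (hp : 2 < p) (ht : 0 < t) : HasDerivAt (f p) (f' p t) t := by
  have h := ((hasDerivAt_pow 2 t).div_const 2).sub
    ((Real.hasDerivAt_rpow_const (p := p) (Or.inl ht.ne')).div_const p)
  refine h.congr_deriv ?_
  have : p ≠ 0 := by linarith
  unfold f'
  field_simp
  norm_num
  ring

theorem hasDerivAt_f' {p t : ℝ} (ht : 0 < t) : HasDerivAt (f' p) (f'' p t) t := by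
  have h := (hasDerivAt_id t).sub (Real.hasDerivAt_rpow_const (p := p - 1) (Or.inl ht.ne'))
  refine h.congr_deriv ?_
  unfold f''
  rw [show p - 1 - 1 = p - 2 by ring]

theorem hasDerivAt_f'' {p t : ℝ} (ht : 0 < t) : HasDerivAt (f'' p) (f''' p t) t := by
  have h := ((Real.hasDerivAt_rpow_const (p := p - 2) (Or.inl ht.ne')).const_mul (p - 1)).const_sub 1
  refine h.congr_deriv ?_
  unfold f'''
  rw [show p - 2 - 1 = p - 3 by ring]
  ring

theorem analyticAt_f {p t : ℝ} (ht : 0 < t) : AnalyticAt ℝ (f p) t :=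
  ((analyticAt_id.pow 2).div_const).sub ((analyticAt_rpow_const ht p).div_const)

theorem f'_one (p : ℝ) : f' p 1 = 0 := by simp [f']

theorem f'_pos {p t : ℝ} (hp : 2 < p) (h0 : 0 < t) (h1 : t < 1) : 0 < f' p t := by
  have := Real.rpow_lt_rpow_of_exponent_gt h0 h1 (show 1 < p - 1 by linarith)
  rw [Real.rpow_one] at this
  unfold f'
  linarith

theorem f'_neg {p t : ℝ} (hp : 2 < p) (h1 : 1 < t) : f' p t < 0 := by
  have := Real.rpow_lt_rpow_of_exponent_lt h1 (show 1 < p - 1 by linarith)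
  rw [Real.rpow_one] at this
  unfold f'
  linarith

theorem f_lt_f_one {p t : ℝ} (hp : 2 < p) (h0 : 0 < t) (h1 : t ≠ 1) : f p t < f p 1 := by
  rcases lt_or_gt_of_ne h1 with h | h
  · refine strictMonoOn_of_deriv_pos (convex_Icc t 1)
      (fun x hx => (hasDerivAt_f hp (h0.trans_le hx.1)).continuousAt.continuousWithinAt) ?_
      (left_mem_Icc.2 h.le) (right_mem_Icc.2 h.le) h
    intro x hx
    rw [interior_Icc] at hx
    rw [(hasDerivAt_f hp (h0.trans hx.1)).deriv]
    exact f'_pos hp (h0.trans hx.1) hx.2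
  · refine strictAntiOn_of_deriv_neg (convex_Icc 1 t)
      (fun x hx => (hasDerivAt_f hp (one_pos.trans_le hx.1)).continuousAt.continuousWithinAt) ?_
      (left_mem_Icc.2 h.le) (right_mem_Icc.2 h.le) h
    intro x hx
    rw [interior_Icc] at hx
    rw [(hasDerivAt_f hp (one_pos.trans hx.1)).deriv]
    exact f'_neg hp hx.1

theorem AnalyticAt.dslope_of_analyticAt {h : ℝ → ℝ} {x₀ t : ℝ} (h₀ : AnalyticAt ℝ h x₀)
    (ht : AnalyticAt ℝ h t) : AnalyticAt ℝ (dslope h x₀) t := by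
  rcases eq_or_ne t x₀ with rfl | hne
  · obtain ⟨q, hq⟩ := h₀
    exact ⟨_, hq.has_fpower_series_dslope_fslope⟩
  · have h1 : AnalyticAt ℝ (fun x => (x - x₀)⁻¹ * (h x - h x₀)) t :=
      ((analyticAt_id.sub analyticAt_const).inv (sub_ne_zero.2 hne)).mul (ht.sub analyticAt_const)
    refine h1.congr ?_
    filter_upwards [dslope_eventuallyEq_slope_of_ne h hne] with x hx
    rw [hx, slope_def_field]
    ring

/-- The factorization `f(1) - f(t) = (t-1)² G(t)` with `G` analytic and positive. -/
theorem exists_factor_f {p : ℝ} (hp : 2 < p) : ∃ G : ℝ → ℝ,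
    (∀ t, 0 < t → AnalyticAt ℝ G t) ∧ (∀ t, 0 < t → 0 < G t) ∧
    ∀ t, f p 1 - f p t = (t - 1) ^ 2 * G t := by
  set k : ℝ → ℝ := dslope (f p) 1 with hk
  have hk1 : k 1 = 0 := by
    rw [hk, dslope_same, (hasDerivAt_f hp one_pos).deriv, f'_one]
  have hkan : ∀ t, 0 < t → AnalyticAt ℝ k t := fun t ht =>
    (analyticAt_f one_pos).dslope_of_analyticAt (analyticAt_f ht)
  have hG : ∀ t, 0 < t → AnalyticAt ℝ (fun t => -dslope k 1 t) t := fun t ht =>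
    ((hkan 1 one_pos).dslope_of_analyticAt (hkan t ht)).neg
  have hfac : ∀ t, f p 1 - f p t = (t - 1) ^ 2 * -dslope k 1 t := by
    intro t
    have h1 := sub_smul_dslope (f p) 1 t
    have h2 := sub_smul_dslope k 1 t
    rw [hk1, sub_zero, smul_eq_mul] at h2
    rw [← hk, ← h2, smul_eq_mul] at h1
    linarith
  refine ⟨fun t => -dslope k 1 t, hG, ?_, hfac⟩
  set G : ℝ → ℝ := fun t => -dslope k 1 t with hGdef
  intro t ht
  rcases eq_or_ne t 1 with rfl | hne
  · have hd : ∀ᶠ x in 𝓝 (1 : ℝ),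
        f' p x = -(2 * (x - 1) * G x + (x - 1) ^ 2 * deriv G x) := by
      filter_upwards [eventually_gt_nhds (one_pos : (0 : ℝ) < 1)] with x hx
      have e1 := (hasDerivAt_f hp hx).const_sub (f p 1)
      have e2 := (((hasDerivAt_id x).sub_const 1).pow 2).mul (hG x hx).differentiableAt.hasDerivAt
      have e3 : (fun x => f p 1 - f p x) = ((id - fun _ => (1 : ℝ)) ^ 2) * G := by
        ext y; exact hfac y
      have e4 := e1.unique (by rw [e3]; exact e2)
      simp at e4
      linarith
    have e1 := hasDerivAt_f' (p := p) (one_pos)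
    have hG1 := (hG 1 one_pos).differentiableAt.hasDerivAt
    have hG2 := (hG 1 one_pos).deriv.differentiableAt.hasDerivAt
    have e2 := (((((hasDerivAt_id (1 : ℝ)).sub_const 1).const_mul 2).mul hG1).add
      ((((hasDerivAt_id (1 : ℝ)).sub_const 1).pow 2).mul hG2)).neg
    have e3 := e1.unique (e2.congr_of_eventuallyEq hd)
    simp [f''] at e3
    change 0 < G 1
    linarith
  · have h1 := f_lt_f_one hp ht hne
    have h2 : 0 < (t - 1) ^ 2 := by
      have := sub_ne_zero.2 hne
      positivity
    have h3 : 0 < (t - 1) ^ 2 * G t := by rw [← hfac t]; linarith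
    exact (mul_pos_iff_of_pos_left h2).1 h3

/-- An analytic coordinate `s = φ(t)` with `s² = f(1) - f(t)`, and its analytic inverse `ψ`. -/
theorem exists_coordinate {p : ℝ} (hp : 2 < p) : ∃ (φ ψ : ℝ → ℝ) (U : Set ℝ),
    IsOpen U ∧ U.OrdConnected ∧ AnalyticOnNhd ℝ ψ U ∧ StrictMonoOn φ (Ioi 0) ∧
    MapsTo φ (Ioi 0) U ∧ MapsTo ψ U (Ioi 0) ∧ LeftInvOn ψ φ (Ioi 0) ∧ LeftInvOn φ ψ U ∧
    φ 1 = 0 ∧ ∀ t, 0 < t → φ t ^ 2 = f p 1 - f p t := by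
  obtain ⟨G, hG, hGpos, hfac⟩ := exists_factor_f hp
  set φ : ℝ → ℝ := fun t => (t - 1) * G t ^ (1 / 2 : ℝ) with hφ
  have hφan : ∀ t, 0 < t → AnalyticAt ℝ φ t := fun t ht =>
    (analyticAt_id.sub analyticAt_const).mul
      ((analyticAt_rpow_const (hGpos t ht) (1 / 2)).comp (hG t ht))
  have hφ1 : φ 1 = 0 := by simp [hφ]
  have hφsq : ∀ t, 0 < t → φ t ^ 2 = f p 1 - f p t := by
    intro t ht
    rw [hfac, hφ, mul_pow, ← Real.sqrt_eq_rpow, Real.sq_sqrt (hGpos t ht).le]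
  have hrt : ∀ t, 0 < t → 0 < G t ^ (1 / 2 : ℝ) := fun t ht => Real.rpow_pos_of_pos (hGpos t ht) _
  have hderiv : ∀ t, 0 < t → 0 < deriv φ t := by
    intro t ht
    have hd := (hφan t ht).differentiableAt.hasDerivAt
    have e2 : 2 * φ t * deriv φ t = -f' p t := by
      have e3 := (hd.pow 2).unique (((hasDerivAt_f hp ht).const_sub (f p 1)).congr_of_eventuallyEq
        ((eventually_gt_nhds ht).mono fun x hx => hφsq x hx))
      simpa using e3
    rcases lt_trichotomy t 1 with h | rfl | h
    · have h1 := f'_pos hp ht h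
      have h2 : φ t < 0 := mul_neg_of_neg_of_pos (by linarith) (hrt t ht)
      by_contra h3
      nlinarith [mul_nonneg_of_nonpos_of_nonpos h2.le (not_lt.1 h3)]
    · have e3 := (((hasDerivAt_id (1 : ℝ)).sub_const 1).mul
        ((analyticAt_rpow_const (hGpos 1 ht) (1 / 2)).comp
          (hG 1 ht)).differentiableAt.hasDerivAt)
      have e4 := hd.unique e3
      rw [e4]
      simpa using hrt 1 ht
    · have h1 := f'_neg hp h
      have h2 : 0 < φ t := mul_pos (by linarith) (hrt t ht)
      by_contra h3
      nlinarith [mul_nonneg h2.le (neg_nonneg.2 (not_lt.1 h3))]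
  have hcont : ContinuousOn φ (Ioi 0) := fun t ht => (hφan t ht).continuousAt.continuousWithinAt
  have hmono : StrictMonoOn φ (Ioi 0) := by
    refine strictMonoOn_of_deriv_pos (convex_Ioi 0) hcont ?_
    intro t ht
    rw [interior_Ioi] at ht
    exact hderiv t ht
  have hinv : LeftInvOn (Function.invFunOn φ (Ioi 0)) φ (Ioi 0) := hmono.injOn.leftInvOn_invFunOn
  refine ⟨φ, Function.invFunOn φ (Ioi 0), φ '' Ioi 0, ?_, ?_, ?_, hmono, mapsTo_image _ _, ?_,
    hinv, ?_, hφ1, hφsq⟩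
  · rw [isOpen_iff_mem_nhds]
    rintro _ ⟨t, ht, rfl⟩
    rw [← (hφan t ht).hasStrictDerivAt.map_nhds_eq (hderiv t ht).ne']
    exact image_mem_map (Ioi_mem_nhds ht)
  · exact (ordConnected_Ioi.isPreconnected.image _ hcont).ordConnected
  · rintro _ ⟨t, ht, rfl⟩
    rw [← analyticAt_comp_iff_of_deriv_ne_zero (hφan t ht) (hderiv t ht).ne']
    refine analyticAt_id.congr ?_
    filter_upwards [eventually_gt_nhds ht] with x hx
    exact (hinv hx).symm
  · rintro _ ⟨t, ht, rfl⟩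
    rw [hinv ht]
    exact ht
  · rintro _ ⟨t, ht, rfl⟩
    rw [hinv ht]

theorem mul_sin_mem {U : Set ℝ} {r : ℝ} (hr : 0 ≤ r) (hU : Icc (-r) r ⊆ U) (θ : ℝ) :
    r * Real.sin θ ∈ U :=
  hU ⟨by nlinarith [Real.neg_one_le_sin θ], by nlinarith [Real.sin_le_one θ]⟩

theorem continuous_comp_mul_sin {U : Set ℝ} {h : ℝ → ℝ} (hh : AnalyticOnNhd ℝ h U) {r : ℝ}
    (hr : 0 ≤ r) (hU : Icc (-r) r ⊆ U) : Continuous fun θ => h (r * Real.sin θ) :=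
  hh.continuousOn.comp_continuous (by fun_prop) (mul_sin_mem hr hU)

theorem hasDerivAt_comp_mul_sin {U : Set ℝ} {h : ℝ → ℝ} (hh : AnalyticOnNhd ℝ h U) {r : ℝ}
    (hr : 0 ≤ r) (hU : Icc (-r) r ⊆ U) (θ : ℝ) :
    HasDerivAt (fun θ => h (r * Real.sin θ))
      (deriv h (r * Real.sin θ) * (r * Real.cos θ)) θ :=
  (hh _ (mul_sin_mem hr hU θ)).differentiableAt.hasDerivAt.comp θ
    ((Real.hasDerivAt_sin θ).const_mul r)

theorem hasDerivAt_integral_comp_mul_sin {U : Set ℝ} (hUo : IsOpen U) (hUc : U.OrdConnected)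
    {h : ℝ → ℝ} (hh : AnalyticOnNhd ℝ h U) {r : ℝ} (hr : 0 < r) (hU : Icc (-r) r ⊆ U) :
    HasDerivAt (fun x => ∫ θ in -(Real.pi / 2)..(Real.pi / 2), h (x * Real.sin θ))
      (∫ θ in -(Real.pi / 2)..(Real.pi / 2), deriv h (r * Real.sin θ) * Real.sin θ) r := by
  obtain ⟨R, hR, hRU⟩ : ∃ R, r < R ∧ Icc (-R) R ⊆ U := by
    have h1 : ∀ᶠ x in 𝓝 r, x ∈ U := hUo.mem_nhds (hU ⟨by linarith, le_rfl⟩)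
    have h2 : ∀ᶠ x in 𝓝 r, -x ∈ U :=
      continuous_neg.continuousAt.eventually (hUo.mem_nhds (hU ⟨le_rfl, by linarith⟩))
    obtain ⟨R, ⟨hR1, hR2⟩, hR3⟩ :=
      (((h1.and h2).filter_mono nhdsWithin_le_nhds).and (self_mem_nhdsWithin (s := Ioi r))).exists
    exact ⟨R, hR3, hUc.out hR2 hR1⟩
  have hsub : ∀ x ∈ Ioo 0 R, Icc (-x) x ⊆ U := fun x hx =>
    (Icc_subset_Icc (by linarith [hx.2]) hx.2.le).trans hRU
  obtain ⟨C, hC⟩ := (isCompact_Icc (a := -R) (b := R)).exists_bound_of_continuousOn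
    (hh.deriv.continuousOn.mono hRU)
  have hnhds : Ioo 0 R ∈ 𝓝 r := Ioo_mem_nhds hr hR
  refine (intervalIntegral.hasDerivAt_integral_of_dominated_loc_of_deriv_le (bound := fun _ => C)
    (F := fun x θ => h (x * Real.sin θ)) (F' := fun x θ => deriv h (x * Real.sin θ) * Real.sin θ)
    hnhds ?_ ?_ ?_ ?_ ?_ ?_).2
  · filter_upwards [hnhds] with x hx
    exact (continuous_comp_mul_sin hh hx.1.le (hsub x hx)).aestronglyMeasurable
  · exact (continuous_comp_mul_sin hh hr.le hU).intervalIntegrable _ _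
  · exact ((continuous_comp_mul_sin hh.deriv hr.le hU).mul
      Real.continuous_sin).aestronglyMeasurable
  · refine ae_of_all _ fun θ _ x hx => ?_
    have h1 := hC _ (mul_sin_mem (U := Icc (-R) R) (hx.1.le)
      (Icc_subset_Icc (by linarith [hx.2]) hx.2.le) θ)
    rw [norm_mul]
    refine (mul_le_of_le_one_right (norm_nonneg _) ?_).trans h1
    exact Real.abs_sin_le_one θ
  · exact intervalIntegrable_const
  · refine ae_of_all _ fun θ _ x hx => ?_
    have h1 := (hh _ (mul_sin_mem hx.1.le (hsub x hx) θ)).differentiableAt.hasDerivAt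
    exact h1.comp x (by simpa using (hasDerivAt_id x).mul_const (Real.sin θ))

theorem integral_comp_mul_sin_eq_cos_sq {U : Set ℝ} {h : ℝ → ℝ} (hh : AnalyticOnNhd ℝ h U)
    {r : ℝ} (hr : 0 ≤ r) (hU : Icc (-r) r ⊆ U) :
    ∫ θ in -(Real.pi / 2)..(Real.pi / 2), Real.cos θ ^ 2 *
      (2 * h (r * Real.sin θ) + r * Real.sin θ * deriv h (r * Real.sin θ)) =
    ∫ θ in -(Real.pi / 2)..(Real.pi / 2), h (r * Real.sin θ) := by
  have c0 := continuous_comp_mul_sin hh hr hU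
  have c1 := continuous_comp_mul_sin hh.deriv hr hU
  have hc : Continuous fun θ => Real.cos θ ^ 2 *
      (2 * h (r * Real.sin θ) + r * Real.sin θ * deriv h (r * Real.sin θ)) :=
    (Real.continuous_cos.pow 2).mul
      ((c0.const_mul 2).add ((Real.continuous_sin.const_mul r).mul c1))
  rw [← sub_eq_zero, ← intervalIntegral.integral_sub
    (hc.intervalIntegrable _ _) (c0.intervalIntegrable _ _)]
  have hd : ∀ θ, HasDerivAt (fun θ => Real.sin θ * Real.cos θ * h (r * Real.sin θ))
      (Real.cos θ ^ 2 * (2 * h (r * Real.sin θ) + r * Real.sin θ * deriv h (r * Real.sin θ)) -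
        h (r * Real.sin θ)) θ := by
    intro θ
    refine (((Real.hasDerivAt_sin θ).mul (Real.hasDerivAt_cos θ)).mul
      (hasDerivAt_comp_mul_sin hh hr hU θ)).congr_deriv ?_
    simp only [Pi.mul_apply]
    linear_combination h (r * Real.sin θ) * Real.sin_sq_add_cos_sq θ * (-1 : ℝ)
  rw [intervalIntegral.integral_eq_sub_of_hasDerivAt (fun θ _ => hd θ)
    ((hc.sub c0).intervalIntegrable _ _)]
  simp

theorem integral_comp_mul_sin_mul_sin {U : Set ℝ} {h : ℝ → ℝ} (hh : AnalyticOnNhd ℝ h U)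
    {r : ℝ} (hr : 0 ≤ r) (hU : Icc (-r) r ⊆ U) :
    ∫ θ in -(Real.pi / 2)..(Real.pi / 2), h (r * Real.sin θ) * Real.sin θ =
    r * ∫ θ in -(Real.pi / 2)..(Real.pi / 2), Real.cos θ ^ 2 * deriv h (r * Real.sin θ) := by
  have c0 := continuous_comp_mul_sin hh hr hU
  have c1 := continuous_comp_mul_sin hh.deriv hr hU
  have hc0 : Continuous fun θ => h (r * Real.sin θ) * Real.sin θ := c0.mul Real.continuous_sin
  have hc1 : Continuous fun θ => r * (Real.cos θ ^ 2 * deriv h (r * Real.sin θ)) :=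
    ((Real.continuous_cos.pow 2).mul c1).const_mul r
  rw [← intervalIntegral.integral_const_mul, ← sub_eq_zero, ← intervalIntegral.integral_sub
    (hc0.intervalIntegrable _ _) (hc1.intervalIntegrable _ _)]
  have hd : ∀ θ, HasDerivAt (fun θ => -Real.cos θ * h (r * Real.sin θ))
      (h (r * Real.sin θ) * Real.sin θ -
        r * (Real.cos θ ^ 2 * deriv h (r * Real.sin θ))) θ := by
    intro θ
    refine ((Real.hasDerivAt_cos θ).neg.mul
      (hasDerivAt_comp_mul_sin hh hr hU θ)).congr_deriv ?_
    simp only [Pi.neg_apply]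
    ring
  rw [intervalIntegral.integral_eq_sub_of_hasDerivAt (fun θ _ => hd θ)
    ((hc0.sub hc1).intervalIntegrable _ _)]
  simp

/-- The change of variables `t = ψ(r sin θ)`. -/
theorem integral_eq_integral_comp_mul_sin {φ ψ : ℝ → ℝ} {U : Set ℝ} (hUo : IsOpen U)
    (hψ : AnalyticOnNhd ℝ ψ U) (hφ : StrictMonoOn φ (Ioi 0)) (hψU : MapsTo ψ U (Ioi 0))
    (hl : LeftInvOn ψ φ (Ioi 0)) (hr : LeftInvOn φ ψ U) {r a b : ℝ} (h0 : 0 < r)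
    (hU : Icc (-r) r ⊆ U) (ha : 0 < a) (hb : 0 < b) (hφa : φ a = -r) (hφb : φ b = r)
    (F : ℝ → ℝ) :
    ∫ t in a..b, F t = ∫ θ in -(Real.pi / 2)..(Real.pi / 2),
      deriv ψ (r * Real.sin θ) * (r * Real.cos θ) * F (ψ (r * Real.sin θ)) := by
  have hab : a ≤ b := (hφ.le_iff_le ha hb).1 (by rw [hφa, hφb]; linarith)
  have hpi : -(Real.pi / 2) ≤ Real.pi / 2 := by linarith [Real.pi_pos]
  have hψmono : MonotoneOn ψ U := fun x hx y hy hxy =>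
    (hφ.le_iff_le (hψU hx) (hψU hy)).1 (by rwa [hr hx, hr hy])
  have hψpos : ∀ s ∈ U, 0 ≤ deriv ψ s := fun s hs => by
    rw [← derivWithin_of_isOpen hUo hs]
    exact hψmono.derivWithin_nonneg
  have himage : (fun θ => ψ (r * Real.sin θ)) '' Ioo (-(Real.pi / 2)) (Real.pi / 2) = Ioo a b := by
    ext t
    constructor
    · rintro ⟨θ, hθ, rfl⟩
      have hm := mul_sin_mem h0.le hU θ
      have hsin : Real.sin θ ∈ Ioo (-1 : ℝ) 1 := by
        rw [← Real.sin_pi_div_two, ← Real.sin_neg]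
        exact ⟨Real.strictMonoOn_sin (left_mem_Icc.2 hpi) (Ioo_subset_Icc_self hθ) hθ.1,
          Real.strictMonoOn_sin (Ioo_subset_Icc_self hθ) (right_mem_Icc.2 hpi) hθ.2⟩
      constructor
      · rw [← hφ.lt_iff_lt ha (hψU hm), hφa, hr hm]
        nlinarith [hsin.1]
      · rw [← hφ.lt_iff_lt (hψU hm) hb, hφb, hr hm]
        nlinarith [hsin.2]
    · intro ht
      have ht0 : 0 < t := ha.trans ht.1
      have h1 : -r < φ t := by rw [← hφa]; exact hφ ha ht0 ht.1
      have h2 : φ t < r := by rw [← hφb]; exact hφ ht0 hb ht.2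
      have h3 : -1 < φ t / r := by rw [lt_div_iff₀ h0]; linarith
      have h4 : φ t / r < 1 := by rw [div_lt_iff₀ h0]; linarith
      refine ⟨Real.arcsin (φ t / r), ⟨Real.neg_pi_div_two_lt_arcsin.2 h3,
        Real.arcsin_lt_pi_div_two.2 h4⟩, ?_⟩
      dsimp only
      rw [Real.sin_arcsin h3.le h4.le, mul_div_cancel₀ _ h0.ne', hl ht0]
  have hinj : InjOn (fun θ => ψ (r * Real.sin θ)) (Ioo (-(Real.pi / 2)) (Real.pi / 2)) := by
    intro x hx y hy hxy
    have h1 : r * Real.sin x = r * Real.sin y := by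
      rw [← hr (mul_sin_mem h0.le hU x), ← hr (mul_sin_mem h0.le hU y)]
      exact congrArg φ hxy
    exact Real.injOn_sin (Ioo_subset_Icc_self hx) (Ioo_subset_Icc_self hy)
      (mul_left_cancel₀ h0.ne' h1)
  rw [intervalIntegral.integral_of_le hab, intervalIntegral.integral_of_le hpi,
    integral_Ioc_eq_integral_Ioo, integral_Ioc_eq_integral_Ioo, ← himage,
    integral_image_eq_integral_abs_deriv_smul measurableSet_Ioo
      (fun θ _ => (hasDerivAt_comp_mul_sin hψ h0.le hU θ).hasDerivWithinAt) hinj]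
  refine setIntegral_congr_fun measurableSet_Ioo fun θ hθ => ?_
  rw [abs_of_nonneg (mul_nonneg (hψpos _ (mul_sin_mem h0.le hU θ))
    (mul_nonneg h0.le (Real.cos_pos_of_mem_Ioo hθ).le)), smul_eq_mul]

/-- The relations between the derivatives of `f` and those of a parametrization `ψ` with
`f(ψ(s)) = c - s²`. -/
theorem deriv_relations {p c : ℝ} (hp : 2 < p) {ψ : ℝ → ℝ} {U : Set ℝ} (hUo : IsOpen U)
    (hψ : AnalyticOnNhd ℝ ψ U) (hψU : MapsTo ψ U (Ioi 0))
    (hf : ∀ s ∈ U, f p (ψ s) = c - s ^ 2) {s : ℝ} (hs : s ∈ U) :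
    f' p (ψ s) * deriv ψ s = -2 * s ∧
    f'' p (ψ s) * deriv ψ s ^ 2 + f' p (ψ s) * deriv (deriv ψ) s = -2 ∧
    f''' p (ψ s) * deriv ψ s ^ 3 + 3 * f'' p (ψ s) * deriv ψ s * deriv (deriv ψ) s +
      f' p (ψ s) * deriv (deriv (deriv ψ)) s = 0 := by
  have d1 : ∀ s ∈ U, HasDerivAt ψ (deriv ψ s) s := fun s hs =>
    (hψ s hs).differentiableAt.hasDerivAt
  have d2 : ∀ s ∈ U, HasDerivAt (deriv ψ) (deriv (deriv ψ) s) s := fun s hs =>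
    (hψ.deriv s hs).differentiableAt.hasDerivAt
  have d3 : ∀ s ∈ U, HasDerivAt (deriv (deriv ψ)) (deriv (deriv (deriv ψ)) s) s := fun s hs =>
    (hψ.deriv.deriv s hs).differentiableAt.hasDerivAt
  have e1 : ∀ s ∈ U, f' p (ψ s) * deriv ψ s = -2 * s := fun s hs => by
    have h1 := (hasDerivAt_f hp (hψU hs)).comp s (d1 s hs)
    have h2 := (((hasDerivAt_id s).pow 2).const_sub c).congr_of_eventuallyEq
      (f₁ := f p ∘ ψ) (mem_of_superset (hUo.mem_nhds hs) hf)
    simpa using h1.unique h2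
  have e2 : ∀ s ∈ U, f'' p (ψ s) * deriv ψ s ^ 2 + f' p (ψ s) * deriv (deriv ψ) s = -2 :=
    fun s hs => by
    have h1 := ((hasDerivAt_f' (p := p) (hψU hs)).comp s (d1 s hs)).mul (d2 s hs)
    have h2 := ((hasDerivAt_id s).const_mul (-2)).congr_of_eventuallyEq
      (f₁ := (f' p ∘ ψ) * deriv ψ) (mem_of_superset (hUo.mem_nhds hs) e1)
    have h3 := h1.unique h2
    simp only [Function.comp_apply] at h3
    linarith
  refine ⟨e1 s hs, e2 s hs, ?_⟩
  have h1 := (((hasDerivAt_f'' (p := p) (hψU hs)).comp s (d1 s hs)).mul ((d2 s hs).pow 2)).add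
    (((hasDerivAt_f' (p := p) (hψU hs)).comp s (d1 s hs)).mul (d3 s hs))
  have h2 := (hasDerivAt_const s (-2 : ℝ)).congr_of_eventuallyEq
    (f₁ := (f'' p ∘ ψ) * deriv ψ ^ 2 + (f' p ∘ ψ) * deriv (deriv ψ))
    (mem_of_superset (hUo.mem_nhds hs) fun x hx => by simpa using e2 x hx)
  have h3 := h1.unique h2
  simp only [Function.comp_apply, Pi.pow_apply] at h3
  norm_num at h3
  linarith

/-- for `p > 2` and `z ∈ (0,(p/2)^(1/(p-2))) \ {1}`, with `a(z) ∈ (0,1)` and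
`b(z) ∈ (1,(p/2)^(1/(p-2)))` the unique points where `f(a(z)) = f(b(z)) = f(z)`, and
`L₁(z) = (1/√2) ∫_{a(z)}^{b(z)} dt/√(f(t)-f(z))`, the two identities of
Lemma `identidades_L_derL` hold; in particular `L₁` is differentiable at `z`. -/
theorem stmt_14 (p : ℝ) (hp : 2 < p) (a b : ℝ → ℝ)
    (hab : ∀ z ∈ Set.Ioo (0 : ℝ) ((p / 2) ^ (1 / (p - 2))) \ {1},
      a z ∈ Set.Ioo (0 : ℝ) 1 ∧ b z ∈ Set.Ioo (1 : ℝ) ((p / 2) ^ (1 / (p - 2))) ∧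
      f p (a z) = f p z ∧ f p (b z) = f p z)
    (L₁ : ℝ → ℝ)
    (hL₁ : ∀ z ∈ Set.Ioo (0 : ℝ) ((p / 2) ^ (1 / (p - 2))) \ {1},
      L₁ z = (1 / Real.sqrt 2) * ∫ t in (a z)..(b z), 1 / Real.sqrt (f p t - f p z))
    (z : ℝ) (hz : z ∈ Set.Ioo (0 : ℝ) ((p / 2) ^ (1 / (p - 2))) \ {1}) :
    (Real.sqrt 2 * L₁ z * (f p z - f p 1) =
      -∫ t in (a z)..(b z), Real.sqrt (f p t - f p z) *
        (3 - 2 * (f p t - f p 1) * f'' p t / (f' p t) ^ 2)) ∧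
    ∃ d : ℝ, HasDerivAt L₁ d z ∧
      Real.sqrt 2 * d * (f p z - f p 1) =
        -f' p z * ∫ t in (a z)..(b z),
          Real.sqrt (f p t - f p z) * g p t / (f' p t) ^ 4 := by
  obtain ⟨φ, ψ, U, hUo, hUc, hψ, hφ, hφU, hψU, hl, hr, hφ1, hφsq⟩ := exists_coordinate hp
  have hfψ : ∀ s ∈ U, f p (ψ s) = f p 1 - s ^ 2 := fun s hs => by
    have := hφsq _ (hψU hs)
    rw [hr hs] at this
    linarith
  set D := Ioo (0 : ℝ) ((p / 2) ^ (1 / (p - 2))) \ {1}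
  have hDo : IsOpen D := isOpen_Ioo.sdiff isClosed_singleton
  have hpos : ∀ w ∈ D, 0 < f p 1 - f p w := fun w hw =>
    sub_pos.2 (f_lt_f_one hp hw.1.1 hw.2)
  have hρ : ∀ w ∈ D, φ (a w) = -√(f p 1 - f p w) ∧ φ (b w) = √(f p 1 - f p w) := by
    intro w hw
    obtain ⟨ha, hb, hfa, hfb⟩ := hab w hw
    have hb0 : 0 < b w := one_pos.trans hb.1
    have ha' := hφ ha.1 (mem_Ioi.2 one_pos) ha.2
    have hb' := hφ (mem_Ioi.2 one_pos) hb0 hb.1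
    rw [hφ1] at ha' hb'
    constructor
    · rw [← hfa, ← hφsq _ ha.1, Real.sqrt_sq_eq_abs, abs_of_neg ha', neg_neg]
    · rw [← hfb, ← hφsq _ hb0, Real.sqrt_sq_eq_abs, abs_of_pos hb']
  have hUw : ∀ w ∈ D, Icc (-√(f p 1 - f p w)) (√(f p 1 - f p w)) ⊆ U := by
    intro w hw
    obtain ⟨ha, hb, -⟩ := hab w hw
    rw [← (hρ w hw).1, ← (hρ w hw).2]
    exact hUc.out (hφU ha.1) (hφU (one_pos.trans hb.1))
  have hcov : ∀ w ∈ D, ∀ F : ℝ → ℝ, ∫ t in (a w)..(b w), F t =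
      ∫ θ in -(Real.pi / 2)..(Real.pi / 2),
        deriv ψ (√(f p 1 - f p w) * Real.sin θ) * (√(f p 1 - f p w) * Real.cos θ) *
          F (ψ (√(f p 1 - f p w) * Real.sin θ)) := fun w hw F =>
    integral_eq_integral_comp_mul_sin hUo hψ hφ hψU hl hr (Real.sqrt_pos.2 (hpos w hw))
      (hUw w hw) (hab w hw).1.1 (one_pos.trans (hab w hw).2.1.1) (hρ w hw).1 (hρ w hw).2 F
  have hsqrt : ∀ w ∈ D, ∀ θ ∈ Ioo (-(Real.pi / 2)) (Real.pi / 2),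
      √(f p (ψ (√(f p 1 - f p w) * Real.sin θ)) - f p w) = √(f p 1 - f p w) * Real.cos θ := by
    intro w hw θ hθ
    have hc := Real.cos_pos_of_mem_Ioo hθ
    rw [hfψ _ (mul_sin_mem (Real.sqrt_nonneg _) (hUw w hw) θ)]
    refine (Real.sqrt_eq_iff_mul_self_eq_of_pos (mul_pos (Real.sqrt_pos.2 (hpos w hw)) hc)).2 ?_
    rw [← sq, mul_pow, mul_pow, Real.sq_sqrt (hpos w hw).le]
    linear_combination (f p 1 - f p w) * Real.sin_sq_add_cos_sq θ
  have hpi : -(Real.pi / 2) ≤ Real.pi / 2 := by linarith [Real.pi_pos]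
  have hcongr : ∀ F H : ℝ → ℝ,
      (∀ θ ∈ Ioo (-(Real.pi / 2)) (Real.pi / 2), Real.sin θ ≠ 0 → F θ = H θ) →
      ∫ θ in -(Real.pi / 2)..(Real.pi / 2), F θ = ∫ θ in -(Real.pi / 2)..(Real.pi / 2), H θ := by
    intro F H hFH
    rw [intervalIntegral.integral_of_le hpi, intervalIntegral.integral_of_le hpi,
      integral_Ioc_eq_integral_Ioo, integral_Ioc_eq_integral_Ioo]
    refine setIntegral_congr_ae measurableSet_Ioo ?_
    filter_upwards [compl_mem_ae_iff.2 (measure_singleton (0 : ℝ))] with θ hθ0 hθ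
    refine hFH θ hθ fun h => hθ0 ?_
    refine (Real.sin_eq_zero_iff_of_lt_of_lt ?_ ?_).1 h <;> linarith [hθ.1, hθ.2, Real.pi_pos]
  have hL : ∀ w ∈ D, L₁ w = 1 / √2 * ∫ θ in -(Real.pi / 2)..(Real.pi / 2),
      deriv ψ (√(f p 1 - f p w) * Real.sin θ) := by
    intro w hw
    rw [hL₁ w hw, hcov w hw]
    congr 1
    refine hcongr _ _ fun θ hθ _ => ?_
    have h1 := (mul_pos (Real.sqrt_pos.2 (hpos w hw)) (Real.cos_pos_of_mem_Ioo hθ)).ne'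
    rw [hsqrt w hw θ hθ, mul_assoc, mul_one_div_cancel h1, mul_one]
  have h2 : √(2 : ℝ) ≠ 0 := by positivity
  set r := √(f p 1 - f p z) with hrdef
  have hr0 : 0 < r := Real.sqrt_pos.2 (hpos z hz)
  have hr2 : f p z - f p 1 = -r ^ 2 := by rw [Real.sq_sqrt (hpos z hz).le]; ring
  have hrU : Icc (-r) r ⊆ U := hUw z hz
  rw [hr2]
  have hderiv := (((hasDerivAt_integral_comp_mul_sin hUo hUc hψ.deriv hr0 hrU).comp z
    (((hasDerivAt_f hp hz.1.1).const_sub (f p 1)).sqrt (hpos z hz).ne')).const_mul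
      (1 / √2)).congr_of_eventuallyEq (mem_of_superset (hDo.mem_nhds hz) hL)
  refine ⟨?_, _, hderiv, ?_⟩
  · rw [hL z hz, hcov z hz, ← integral_comp_mul_sin_eq_cos_sq hψ.deriv hr0.le hrU,
      ← mul_assoc, mul_one_div_cancel h2, one_mul, mul_neg, mul_comm,
      ← intervalIntegral.integral_const_mul]
    congr 1
    refine hcongr _ _ fun θ hθ hθ0 => ?_
    rw [hsqrt z hz θ hθ, ← hrdef]
    have hs := mul_sin_mem hr0.le hrU θ
    have hs0 : r * Real.sin θ ≠ 0 := mul_ne_zero hr0.ne' hθ0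
    obtain ⟨e1, e2, -⟩ := deriv_relations hp hUo hψ hψU hfψ hs
    rw [hfψ _ hs]
    generalize r * Real.sin θ = s at *
    generalize deriv (deriv ψ) s = ψ₂ at *
    generalize deriv ψ s = ψ₁ at *
    have hψ₁ : ψ₁ ≠ 0 := by rintro rfl; simp_all
    rw [show f'' p (ψ s) = (-2 - f' p (ψ s) * ψ₂) / ψ₁ ^ 2 by field_simp; linarith,
      show f' p (ψ s) = -2 * s / ψ₁ by field_simp; linarith]
    field_simp
    ring
  · rw [integral_comp_mul_sin_mul_sin hψ.deriv.deriv hr0.le hrU, hcov z hz]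
    have hint : ∫ θ in -(Real.pi / 2)..(Real.pi / 2),
        deriv ψ (r * Real.sin θ) * (r * Real.cos θ) *
          (√(f p (ψ (r * Real.sin θ)) - f p z) * g p (ψ (r * Real.sin θ)) /
            f' p (ψ (r * Real.sin θ)) ^ 4) =
        -r ^ 2 / 2 * ∫ θ in -(Real.pi / 2)..(Real.pi / 2),
          Real.cos θ ^ 2 * deriv (deriv (deriv ψ)) (r * Real.sin θ) := by
      rw [← intervalIntegral.integral_const_mul]
      refine hcongr _ _ fun θ hθ hθ0 => ?_
      rw [hsqrt z hz θ hθ, ← hrdef]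
      have hs := mul_sin_mem hr0.le hrU θ
      have hs0 : r * Real.sin θ ≠ 0 := mul_ne_zero hr0.ne' hθ0
      obtain ⟨e1, e2, e3⟩ := deriv_relations hp hUo hψ hψU hfψ hs
      rw [g, hfψ _ hs]
      generalize r * Real.sin θ = s at *
      generalize deriv (deriv (deriv ψ)) s = ψ₃ at *
      generalize deriv (deriv ψ) s = ψ₂ at *
      generalize deriv ψ s = ψ₁ at *
      have hψ₁ : ψ₁ ≠ 0 := by rintro rfl; simp_all
      rw [show f''' p (ψ s) = -(3 * f'' p (ψ s) * ψ₁ * ψ₂ + f' p (ψ s) * ψ₃) / ψ₁ ^ 3 by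
          field_simp; linarith,
        show f'' p (ψ s) = (-2 - f' p (ψ s) * ψ₂) / ψ₁ ^ 2 by field_simp; linarith,
        show f' p (ψ s) = -2 * s / ψ₁ by field_simp; linarith]
      field_simp
      ring
    rw [hint, ← hrdef]
    field_simp
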